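/- With the fixed-pair setup in a diregular (2,k,+3)-digraph with k ≥ 3: v₁ ∈ O(u) and u₁ ∈ O(v). -/

import Mathlib

/-- `p` is a directed walk from `u` to `v` in the digraph with arc relation `A`,
recorded as the list of its vertices; a walk of length `l` (i.e. with `l` arcs)
is a list of `l + 1` vertices. -/
def IsWalkFrom {V : Type*} (A : V → V → Prop) (u v : V) (p : List V) : Prop :=
  p.Chain' A ∧ p.head? = some u ∧ p.getLast? = some v

/-- A digraph is `k`-geodetic if for every ordered pair of vertices `(u, v)`
there is at most one directed path of length at most `k` from `u` to `v`. -/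
def IsKGeodetic {V : Type*} (A : V → V → Prop) (k : ℕ) : Prop :=
  ∀ (u v : V) (p q : List V), IsWalkFrom A u v p → IsWalkFrom A u v q →
    p.length ≤ k + 1 → q.length ≤ k + 1 → p = q

/-- `Nout A u = N⁺(u)`, the set of out-neighbours of `u`. -/
def Nout {V : Type*} (A : V → V → Prop) (u : V) : Set V := {v | A u v}

/-- `Nin A u = N⁻(u)`, the set of in-neighbours of `u`. -/
def Nin {V : Type*} (A : V → V → Prop) (u : V) : Set V := {v | A v u}

/-- `NIter A l u = N^l(u)`, the set of vertices reachable from `u` by a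
directed path of length exactly `l`. -/
def NIter {V : Type*} (A : V → V → Prop) (l : ℕ) (u : V) : Set V :=
  {v | ∃ p : List V, IsWalkFrom A u v p ∧ p.length = l + 1}

/-- `Ball A l u = T_l(u) = N^0(u) ∪ N^1(u) ∪ ⋯ ∪ N^l(u)`, the set of vertices
at distance at most `l` from `u`. -/
def Ball {V : Type*} (A : V → V → Prop) (l : ℕ) (u : V) : Set V :=
  {v | ∃ m ≤ l, v ∈ NIter A m u}

/-- `Outliers A k u = O(u) = {v | d(u,v) ≥ k + 1}`, the outlier set of `u`. -/
def Outliers {V : Type*} (A : V → V → Prop) (k : ℕ) (u : V) : Set V :=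
  {v | v ∉ Ball A k u}

/-- A digraph is diregular with degree `d` if every vertex has out-degree `d`
and in-degree `d`. -/
def IsDiregular {V : Type*} (A : V → V → Prop) (d : ℕ) : Prop :=
  ∀ u : V, (Nout A u).ncard = d ∧ (Nin A u).ncard = d

/-- The Moore bound `M(d,k) = 1 + d + d² + ⋯ + d^k`. -/
def moore (d k : ℕ) : ℕ := ∑ i ∈ Finset.range (k + 1), d ^ i

/-- `Reach A n a b` says that there is a directed walk with exactly `n` arcs from `a` to `b`. -/
def Reach {V : Type*} (A : V → V → Prop) : ℕ → V → V → Prop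
  | 0, a, b => a = b
  | n + 1, a, b => ∃ c, A a c ∧ Reach A n c b

section Reach

variable {V : Type*} {A : V → V → Prop} {k : ℕ}

lemma IsWalkFrom.cons {a c b : V} {p : List V} (h : A a c) (hp : IsWalkFrom A c b p) :
    IsWalkFrom A a b (a :: p) := by
  obtain ⟨h1, h2, h3⟩ := hp
  cases p with
  | nil => simp at h2
  | cons x t =>
    simp only [List.head?_cons, Option.some.injEq] at h2
    subst h2
    exact ⟨List.isChain_cons_cons.2 ⟨h, h1⟩, rfl, by simpa using h3⟩

lemma Reach.exists_walk {n : ℕ} {a b : V} (h : Reach A n a b) :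
    ∃ p, IsWalkFrom A a b p ∧ p.length = n + 1 := by
  induction n generalizing a with
  | zero =>
    obtain rfl : a = b := h
    exact ⟨[a], ⟨List.isChain_singleton a, rfl, rfl⟩, rfl⟩
  | succ n ih =>
    obtain ⟨c, hc, h⟩ := h
    obtain ⟨p, hp, hl⟩ := ih h
    exact ⟨a :: p, hp.cons hc, by simp [hl]⟩

lemma IsWalkFrom.reach {n : ℕ} {a b : V} {p : List V} (hp : IsWalkFrom A a b p)
    (hl : p.length = n + 1) : Reach A n a b := by
  induction n generalizing a p with
  | zero =>
    obtain ⟨x, rfl⟩ := List.length_eq_one_iff.1 hl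
    obtain ⟨-, h2, h3⟩ := hp
    simp only [List.head?_cons, List.getLast?_singleton, Option.some.injEq] at h2 h3
    exact h2.symm.trans h3
  | succ n ih =>
    obtain ⟨h1, h2, h3⟩ := hp
    match p, hl with
    | x :: y :: t, hl =>
      simp only [List.head?_cons, Option.some.injEq] at h2
      subst h2
      obtain ⟨hxy, ht⟩ := List.isChain_cons_cons.1 h1
      exact ⟨y, hxy, ih ⟨ht, rfl, by simpa using h3⟩ (by simpa using hl)⟩

lemma mem_NIter_iff {n : ℕ} {a b : V} : b ∈ NIter A n a ↔ Reach A n a b :=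
  ⟨fun ⟨_, hp, hl⟩ => hp.reach hl, Reach.exists_walk⟩

lemma Reach.trans {m n : ℕ} {a b c : V} (h : Reach A m a b) (h' : Reach A n b c) :
    Reach A (m + n) a c := by
  induction m generalizing a with
  | zero =>
    obtain rfl : a = b := h
    simpa using h'
  | succ m ih =>
    obtain ⟨d, hd, h⟩ := h
    rw [Nat.add_right_comm]
    exact ⟨d, hd, ih h⟩

lemma Reach.of_adj {a b : V} (h : A a b) : Reach A 1 a b := ⟨b, h, rfl⟩

lemma reach_one {a b : V} : Reach A 1 a b ↔ A a b :=
  ⟨fun ⟨_, h, h'⟩ => (show _ = b from h') ▸ h, Reach.of_adj⟩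

lemma Reach.cons {n : ℕ} {a b c : V} (h : A a b) (h' : Reach A n b c) : Reach A (n + 1) a c :=
  ⟨b, h, h'⟩

namespace IsKGeodetic

lemma length_eq (hgeo : IsKGeodetic A k) {m n : ℕ} {a b : V} (h : Reach A m a b)
    (h' : Reach A n a b) (hm : m ≤ k) (hn : n ≤ k) : m = n := by
  obtain ⟨p, hp, hpl⟩ := h.exists_walk
  obtain ⟨q, hq, hql⟩ := h'.exists_walk
  have := hgeo a b p q hp hq (by omega) (by omega)
  subst this
  omega

lemma step_eq (hgeo : IsKGeodetic A k) {m n : ℕ} {a b c d : V} (hc : A a c) (hd : A a d)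
    (h : Reach A m c b) (h' : Reach A n d b) (hm : m + 1 ≤ k) (hn : n + 1 ≤ k) : c = d := by
  obtain ⟨p, hp, hpl⟩ := h.exists_walk
  obtain ⟨q, hq, hql⟩ := h'.exists_walk
  have := hgeo a b _ _ (hp.cons hc) (hq.cons hd) (by simp; omega) (by simp; omega)
  obtain rfl : p = q := by simpa using this
  exact Option.some.inj (hp.2.1.symm.trans hq.2.1)

lemma mid_eq (hgeo : IsKGeodetic A k) {n i j : ℕ} {a b x y : V} (hx : Reach A n a x)
    (hy : Reach A n a y) (hxb : Reach A i x b) (hyb : Reach A j y b)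
    (hi : n + i ≤ k) (hj : n + j ≤ k) : x = y := by
  induction n generalizing a with
  | zero => exact (show a = x from hx).symm.trans hy
  | succ n ih =>
    obtain ⟨c, hc, hx⟩ := hx
    obtain ⟨d, hd, hy⟩ := hy
    obtain rfl := hgeo.step_eq hc hd (hx.trans hxb) (hy.trans hyb) (by omega) (by omega)
    exact ih hx hy (by omega) (by omega)

lemma not_closed (hgeo : IsKGeodetic A k) {n : ℕ} {a : V} (h : Reach A n a a) (h0 : n ≠ 0) :
    k < n := by
  by_contra! hn
  exact h0 (hgeo.length_eq h (show Reach A 0 a a from rfl) hn (Nat.zero_le k))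

end IsKGeodetic

lemma IsDiregular.exists_pair (hreg : IsDiregular A 2) (a : V) :
    ∃ b c, b ≠ c ∧ ∀ x, A a x ↔ x = b ∨ x = c := by
  obtain ⟨b, c, hbc, h⟩ := Set.ncard_eq_two.1 (hreg a).1
  exact ⟨b, c, hbc, fun x => by simpa [Nout] using Set.ext_iff.1 h x⟩

lemma IsDiregular.exists_other (hreg : IsDiregular A 2) {a b : V} (hb : A a b) :
    ∃ c, ∀ x, A a x ↔ x = b ∨ x = c := by
  obtain ⟨c, d, -, h⟩ := hreg.exists_pair a
  rcases (h b).1 hb with rfl | rfl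
  · exact ⟨d, h⟩
  · exact ⟨c, fun x => (h x).trans or_comm⟩

end Reach

section Counting

open scoped Classical in
/-- The vertices reached from `a` by walks with exactly `n` arcs, as a finset. -/
noncomputable def sphere {V : Type*} [Fintype V] (A : V → V → Prop) (n : ℕ) (a : V) : Finset V :=
  {x | Reach A n a x}

open scoped Classical in
/-- The outliers of `a` as a finset. -/
noncomputable def outlierFinset {V : Type*} [Fintype V] (A : V → V → Prop) (k : ℕ) (a : V) :
    Finset V :=
  {x | ∀ m ≤ k, ¬ Reach A m a x}

variable {V : Type*} [Fintype V] {A : V → V → Prop} {k : ℕ}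

lemma mem_sphere {n : ℕ} {a x : V} : x ∈ sphere A n a ↔ Reach A n a x := by simp [sphere]

lemma mem_outlierFinset {a x : V} :
    x ∈ outlierFinset A k a ↔ ∀ m ≤ k, ¬ Reach A m a x := by simp [outlierFinset]

lemma card_sphere (hreg : IsDiregular A 2) (hgeo : IsKGeodetic A k) {n : ℕ} (hn : n ≤ k) (a : V) :
    (sphere A n a).card = 2 ^ n := by
  classical
  induction n generalizing a with
  | zero =>
    have : sphere A 0 a = {a} := by
      ext x
      rw [mem_sphere, Finset.mem_singleton]
      exact eq_comm
    simp [this]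
  | succ n ih =>
    obtain ⟨b, c, hbc, h⟩ := hreg.exists_pair a
    have : sphere A (n + 1) a = sphere A n b ∪ sphere A n c := by
      ext x
      simp only [mem_sphere, Finset.mem_union, Reach, h]
      grind
    rw [this, Finset.card_union_of_disjoint, ih (by omega), ih (by omega), pow_succ, mul_two]
    rw [Finset.disjoint_left]
    intro x hx hx'
    rw [mem_sphere] at hx hx'
    exact hbc (hgeo.step_eq ((h b).2 (.inl rfl)) ((h c).2 (.inr rfl)) hx hx' hn hn)

lemma card_outlierFinset (hreg : IsDiregular A 2) (hgeo : IsKGeodetic A k)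
    (hcard : Fintype.card V = moore 2 k + 3) (a : V) : (outlierFinset A k a).card = 3 := by
  classical
  have hball : (Finset.biUnion (Finset.range (k + 1)) (fun n => sphere A n a)).card
      = moore 2 k := by
    rw [Finset.card_biUnion, moore]
    · refine Finset.sum_congr rfl fun n hn => card_sphere hreg hgeo ?_ a
      simpa [Nat.lt_succ_iff] using hn
    · intro m hm n hn hmn
      refine Finset.disjoint_left.2 fun x hx hx' => ?_
      rw [mem_sphere] at hx hx'
      simp only [Finset.coe_range, Set.mem_Iio] at hm hn
      exact hmn (hgeo.length_eq hx hx' (by omega) (by omega))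
  have hcompl : outlierFinset A k a =
      (Finset.biUnion (Finset.range (k + 1)) (fun n => sphere A n a))ᶜ := by
    ext x
    simp [mem_outlierFinset, mem_sphere]
  rw [hcompl, Finset.card_compl, hball, hcard]
  omega

end Counting

/-- `CommonOut A u v u₁ u₂ v₁`: the out-neighbours of `u` are `u₁, u₂`, those of `v` are
`v₁, u₂`, and these three vertices are distinct. -/
structure CommonOut {V : Type*} (A : V → V → Prop) (u v u₁ u₂ v₁ : V) : Prop where
  left : ∀ x, A u x ↔ x = u₁ ∨ x = u₂
  right : ∀ x, A v x ↔ x = v₁ ∨ x = u₂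
  ne : u₁ ≠ v₁
  ne_left : u₁ ≠ u₂
  ne_right : v₁ ≠ u₂

namespace CommonOut

variable {V : Type*} {A : V → V → Prop} {k : ℕ} {u v u₁ u₂ v₁ : V}

lemma symm (h : CommonOut A u v u₁ u₂ v₁) : CommonOut A v u v₁ u₂ u₁ :=
  ⟨h.right, h.left, h.ne.symm, h.ne_right, h.ne_left⟩

lemma adj_u₁ (h : CommonOut A u v u₁ u₂ v₁) : A u u₁ := (h.left _).2 (.inl rfl)
lemma adj_u₂ (h : CommonOut A u v u₁ u₂ v₁) : A u u₂ := (h.left _).2 (.inr rfl)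
lemma adj_v₁ (h : CommonOut A u v u₁ u₂ v₁) : A v v₁ := (h.right _).2 (.inl rfl)
lemma adj_v₂ (h : CommonOut A u v u₁ u₂ v₁) : A v u₂ := (h.right _).2 (.inr rfl)

/-- If `v₁` reaches `u`, then it needs at least `k - 1` arcs to do so. -/
lemma lt_of_reach (h : CommonOut A u v u₁ u₂ v₁) (hgeo : IsKGeodetic A k) (hk : 1 ≤ k) {m : ℕ}
    (hm : Reach A m v₁ u) : k < m + 2 := by
  by_contra! hlt
  have := hgeo.length_eq ((hm.cons h.adj_v₁).trans (.of_adj h.adj_u₂)) (.of_adj h.adj_v₂)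
    (by omega) hk
  have hmv : m = 0 := by omega
  subst hmv
  obtain rfl : v₁ = u := hm
  exact h.ne_right (hgeo.step_eq h.adj_v₁ h.adj_v₂ (.of_adj h.adj_u₂) (show Reach A 0 _ _ from rfl)
    (by omega) (by omega))

variable [Fintype V]

/-- A vertex within distance `k - 1` of `v₁` is not within distance `k - 1` of `u₂`. -/
lemma cases_of_reach (h : CommonOut A u v u₁ u₂ v₁) (hgeo : IsKGeodetic A k) {n : ℕ} {x : V}
    (hn : n + 1 ≤ k) (hx : Reach A n v₁ x) :
    x = u ∨ (∃ m, m + 1 ≤ k ∧ Reach A m u₁ x) ∨ x ∈ outlierFinset A k u := by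
  by_cases ho : x ∈ outlierFinset A k u
  · exact .inr (.inr ho)
  rw [mem_outlierFinset] at ho
  push Not at ho
  obtain ⟨m, hm, hux⟩ := ho
  cases m with
  | zero => exact .inl (show u = x from hux).symm
  | succ m =>
    obtain ⟨c, hc, hcx⟩ := hux
    rcases (h.left c).1 hc with rfl | rfl
    · exact .inr (.inl ⟨m, hm, hcx⟩)
    · exact absurd (hgeo.step_eq h.adj_v₁ h.adj_v₂ hx hcx hn hm) h.ne_right

/-- Either `v` is an outlier of `u` or it lies at distance `k - 1` from `u₁`. -/
lemma reach_v (h : CommonOut A u v u₁ u₂ v₁) (hgeo : IsKGeodetic A k)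
    (hv : v ∉ outlierFinset A k u) : Reach A (k - 1) u₁ v := by
  rw [mem_outlierFinset] at hv
  push Not at hv
  obtain ⟨m, hm, huv⟩ := hv
  cases m with
  | zero =>
    obtain rfl : u = v := huv
    rcases (h.right u₁).1 h.adj_u₁ with e | e
    exacts [absurd e h.ne, absurd e h.ne_left]
  | succ m =>
    obtain ⟨c, hc, hcv⟩ := huv
    rcases (h.left c).1 hc with rfl | rfl
    · have := h.symm.lt_of_reach hgeo (by omega) hcv
      obtain rfl : m = k - 1 := by omega
      exact hcv
    · have := hgeo.not_closed (hcv.cons h.adj_v₂) (by omega)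
      omega

/-- Walks that leave the ball of radius `k - 1` around `u₁` through `v₁` end in `u` or in an
outlier of `u`. -/
lemma mem_of_reach_boundary (h : CommonOut A u v u₁ u₂ v₁) (hgeo : IsKGeodetic A k)
    {n m j : ℕ} {x y : V} (hx : Reach A n v₁ x) (hu : Reach A m u₁ x) (hy : Reach A j x y)
    (hmj : m + j = k) (hn : n + j + 1 ≤ k) : y = u ∨ y ∈ outlierFinset A k u := by
  rcases h.cases_of_reach hgeo (by omega) (hx.trans hy) with e | ⟨i, hi, hui⟩ | e
  · exact .inl e
  · have := hgeo.length_eq hui (hu.trans hy) (by omega) (by omega)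
    omega
  · exact .inr e

/-- `v₁` is not at distance exactly `k - 1` from `u₁`. -/
lemma not_reach_pred (h : CommonOut A u v u₁ u₂ v₁) (hreg : IsDiregular A 2)
    (hgeo : IsKGeodetic A k) (hcard : Fintype.card V = moore 2 k + 3) (hk : 3 ≤ k) :
    ¬ Reach A (k - 1) u₁ v₁ := by
  classical
  intro hr
  have hO := card_outlierFinset hreg hgeo hcard u
  have hS1 := card_sphere hreg hgeo (n := 1) (by omega) v₁
  have hS2 := card_sphere hreg hgeo (n := 2) (by omega) v₁
  have hsub : sphere A 1 v₁ ⊆ outlierFinset A k u := by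
    intro x hx
    rw [mem_sphere] at hx
    rcases h.mem_of_reach_boundary hgeo (show Reach A 0 v₁ v₁ from rfl) hr hx (by omega)
      (by omega) with rfl | hx'
    · have := h.lt_of_reach hgeo (by omega) hx
      omega
    · exact hx'
  obtain ⟨o, ho⟩ : ∃ o, outlierFinset A k u \ sphere A 1 v₁ = {o} := by
    rw [← Finset.card_eq_one, Finset.card_sdiff_of_subset hsub, hO, hS1]
    rfl
  have hout : ∀ x, x ∈ outlierFinset A k u → Reach A 1 v₁ x ∨ x = o := by
    intro x hx
    by_cases hx1 : x ∈ sphere A 1 v₁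
    · exact .inl (mem_sphere.1 hx1)
    · right
      rw [← Finset.mem_singleton, ← ho]
      exact Finset.mem_sdiff.2 ⟨hx, hx1⟩
  obtain ⟨p, hp, hpv⟩ : ∃ p, A u₁ p ∧ Reach A (k - 2) p v₁ := by
    obtain ⟨j, rfl⟩ : ∃ j, k = j + 2 := ⟨k - 2, by omega⟩
    exact hr
  obtain ⟨q, hq⟩ := hreg.exists_other hp
  have huq : A u₁ q := (hq q).2 (.inr rfl)
  -- the vertices at distance 2 from `v₁` which are close to `u₁`
  have hnear : ∀ x, Reach A 2 v₁ x → ∀ m ≤ 2, Reach A m u₁ x →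
      x = u₁ ∨ x = q ∨ Reach A 1 q x := by
    intro x hx m hm hux
    have hpx := hpv.trans hx
    match m, hm, hux with
    | 0, _, e => exact .inl (show u₁ = x from e).symm
    | m + 1, hm, ⟨c, hc, hcx⟩ =>
      rcases (hq c).1 hc with rfl | rfl
      · have := hgeo.length_eq hcx hpx (by omega) (by omega)
        omega
      · right
        match m, hm, hcx with
        | 0, _, e => exact .inl (show c = x from e).symm
        | 1, _, e => exact .inr e
  have hSq := card_sphere hreg hgeo (n := 1) (by omega) q
  have hqS : Reach A 2 v₁ q → ∀ x, Reach A 1 q x → ¬ Reach A 2 v₁ x := by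
    intro hvq x hx hx'
    have := hgeo.length_eq (hvq.trans hx) hx' (by omega) (by omega)
    omega
  have huS : Reach A 2 v₁ u₁ → ¬ Reach A 2 v₁ q := by
    intro hvu hx'
    have := hgeo.length_eq (hvu.trans (.of_adj huq)) hx' (by omega) (by omega)
    omega
  rcases hk.eq_or_lt with rfl | hk4
  · have hall : ∀ x, Reach A 2 v₁ x → x = o ∨ x = u ∨ x = u₁ ∨ x = q ∨ Reach A 1 q x := by
      intro x hx
      rcases h.cases_of_reach hgeo (by omega) hx with e | ⟨m, hm, hux⟩ | e
      · exact .inr (.inl e)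
      · exact .inr (.inr (hnear x hx m (by omega) hux))
      · rcases hout x e with h1 | h1
        · have := hgeo.length_eq h1 hx (by omega) (by omega)
          omega
        · exact .inl h1
    have hboth : Reach A 2 v₁ u → ¬ Reach A 2 v₁ u₁ := by
      intro hvu hx'
      have := hgeo.length_eq (hvu.trans (.of_adj h.adj_u₁)) hx' (by omega) (by omega)
      omega
    obtain ⟨z, hz⟩ : ∃ z, ∀ x, Reach A 2 v₁ x → x = o ∨ x = z ∨ x = q ∨ Reach A 1 q x := by
      by_cases hvu : Reach A 2 v₁ u
      · refine ⟨u, fun x hx => ?_⟩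
        rcases hall x hx with e | e | rfl | e
        exacts [.inl e, .inr (.inl e), absurd hx (hboth hvu), .inr (.inr e)]
      · refine ⟨u₁, fun x hx => ?_⟩
        rcases hall x hx with e | rfl | e | e
        exacts [.inl e, absurd hx hvu, .inr (.inl e), .inr (.inr e)]
    have hnq : ¬ Reach A 2 v₁ q := by
      intro hvq
      have : sphere A 2 v₁ ⊆ {o, z, q} := by
        intro x hx
        rw [mem_sphere] at hx
        have := hqS hvq x
        have := hz x hx
        simp only [Finset.mem_insert, Finset.mem_singleton]
        tauto
      have := (Finset.card_le_card this).trans Finset.card_le_three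
      omega
    have hsub4 : sphere A 2 v₁ ⊆ {o, z} ∪ sphere A 1 q := by
      intro x hx
      rw [mem_sphere] at hx
      simp only [Finset.mem_union, Finset.mem_insert, Finset.mem_singleton, mem_sphere]
      rcases hz x hx with e | e | rfl | e
      exacts [.inl (.inl e), .inl (.inr e), absurd hx hnq, .inr e]
    have heq : sphere A 2 v₁ = {o, z} ∪ sphere A 1 q := by
      apply Finset.eq_of_subset_of_card_le hsub4
      have h1 := Finset.card_union_le {o, z} (sphere A 1 q)
      have h2 : ({o, z} : Finset V).card ≤ 2 := Finset.card_le_two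
      omega
    have hvo : Reach A 2 v₁ o := by
      rw [← mem_sphere, heq]
      simp
    have hvS : ∀ x, Reach A 1 q x → Reach A 2 v₁ x := by
      intro x hx
      rw [← mem_sphere, heq]
      simp [mem_sphere, hx]
    have hvout : v ∉ outlierFinset A 3 u := by
      intro hv
      rcases hout v hv with e | rfl
      · have := hgeo.not_closed (e.cons h.adj_v₁) (by omega)
        omega
      · have := hgeo.not_closed (hvo.cons h.adj_v₁) (by omega)
        omega
    obtain ⟨c, hc, hcv⟩ : Reach A 2 u₁ v := h.reach_v hgeo hvout
    replace hcv : Reach A 1 c v := hcv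
    rcases (hq c).1 hc with rfl | rfl
    · have := hgeo.length_eq hpv (hcv.trans (.of_adj h.adj_v₁)) (by omega) (by omega)
      omega
    · have := hgeo.not_closed ((hvS v hcv).cons h.adj_v₁) (by omega)
      omega
  · have hfar : ∀ x, Reach A 2 v₁ x → (∀ m ≤ 2, ¬ Reach A m u₁ x) →
        ∃ j, 2 + j ≤ k ∧ Reach A j x o := by
      intro x hx hx2
      rcases h.cases_of_reach hgeo (by omega) hx with rfl | ⟨m, hm, hux⟩ | e
      · have := h.lt_of_reach hgeo (by omega) hx
        omega
      · have hm2 : 2 < m := by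
          by_contra! hle
          exact hx2 m hle hux
        refine ⟨k - m, by omega, ?_⟩
        by_contra hno
        have hsub1 : sphere A (k - m) x ⊆ {u} := by
          intro y hy
          rw [mem_sphere] at hy
          rw [Finset.mem_singleton]
          rcases h.mem_of_reach_boundary hgeo hx hux hy (by omega) (by omega) with e | e
          · exact e
          · rcases hout y e with e | rfl
            · have := hgeo.length_eq e (hx.trans hy) (by omega) (by omega)
              omega
            · exact absurd hy hno
        have h1 := Finset.card_le_card hsub1
        rw [card_sphere hreg hgeo (by omega), Finset.card_singleton] at h1
        have h2 : 2 ^ 1 ≤ 2 ^ (k - m) := Nat.pow_le_pow_right (by omega) (by omega)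
        omega
      · rcases hout x e with h1 | rfl
        · have := hgeo.length_eq h1 hx (by omega) (by omega)
          omega
        · exact ⟨0, by omega, rfl⟩
    obtain ⟨far, hfar_iff⟩ : ∃ far : V → Prop, ∀ x, far x ↔ ∀ m ≤ 2, ¬ Reach A m u₁ x :=
      ⟨_, fun _ => Iff.rfl⟩
    have hfar_card : ((sphere A 2 v₁).filter far).card ≤ 1 := by
      rw [Finset.card_le_one]
      intro x hx y hy
      rw [Finset.mem_filter, mem_sphere, hfar_iff] at hx hy
      obtain ⟨i, hi, hxo⟩ := hfar x hx.1 hx.2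
      obtain ⟨j, hj, hyo⟩ := hfar y hy.1 hy.2
      exact hgeo.mid_eq hx.1 hy.1 hxo hyo hi hj
    have hnear_card :
        ((sphere A 2 v₁).filter (¬ far ·)).card ≤ 2 := by
      have hmem : ∀ x ∈ (sphere A 2 v₁).filter (¬ far ·),
          Reach A 2 v₁ x ∧ (x = u₁ ∨ x = q ∨ Reach A 1 q x) := by
        intro x hx
        rw [Finset.mem_filter, mem_sphere, hfar_iff] at hx
        push Not at hx
        obtain ⟨hx, m, hm, hux⟩ := hx
        exact ⟨hx, hnear x hx m hm hux⟩
      have huS' : Reach A 2 v₁ u₁ → ∀ x, Reach A 1 q x → ¬ Reach A 2 v₁ x := by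
        intro hvu x hx hx'
        have := hgeo.length_eq ((hvu.trans (.of_adj huq)).trans hx) hx' (by omega) (by omega)
        omega
      suffices ∃ s : Finset V, s.card ≤ 2 ∧
          (sphere A 2 v₁).filter (¬ far ·) ⊆ s by
        obtain ⟨s, hs, hss⟩ := this
        exact (Finset.card_le_card hss).trans hs
      by_cases hvu : Reach A 2 v₁ u₁ ∨ Reach A 2 v₁ q
      · refine ⟨{u₁, q}, Finset.card_le_two, fun x hx => ?_⟩
        obtain ⟨hx', e⟩ := hmem x hx
        simp only [Finset.mem_insert, Finset.mem_singleton]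
        rcases e with e | e | e
        · exact .inl e
        · exact .inr e
        · rcases hvu with hvu | hvq
          exacts [absurd hx' (huS' hvu x e), absurd hx' (hqS hvq x e)]
      · push Not at hvu
        refine ⟨sphere A 1 q, by omega, fun x hx => ?_⟩
        obtain ⟨hx', e⟩ := hmem x hx
        rcases e with rfl | rfl | e
        exacts [absurd hx' hvu.1, absurd hx' hvu.2, mem_sphere.2 e]
    have := Finset.card_filter_add_card_filter_not (s := sphere A 2 v₁)
      far
    omega

/-- `v₁` is not within distance `k` of `u`. -/
lemma mem_outliers (h : CommonOut A u v u₁ u₂ v₁) (hreg : IsDiregular A 2)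
    (hgeo : IsKGeodetic A k) (hcard : Fintype.card V = moore 2 k + 3) (hk : 3 ≤ k) :
    v₁ ∈ Outliers A k u := by
  classical
  have hO := card_outlierFinset hreg hgeo hcard u
  rintro ⟨m, hm, hm'⟩
  rw [mem_NIter_iff] at hm'
  rcases h.cases_of_reach hgeo (by omega) (show Reach A 0 v₁ v₁ from rfl) with
    rfl | ⟨l, hl, hul⟩ | ho
  · have := h.lt_of_reach hgeo (by omega) (show Reach A 0 v₁ v₁ from rfl)
    omega
  · have hl0 : l ≠ 0 := by
      rintro rfl
      exact h.ne hul
    have hl1 : l ≠ k - 1 := by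
      rintro rfl
      exact h.not_reach_pred hreg hgeo hcard hk hul
    have hsub : sphere A (k - l) v₁ ⊆ insert u (outlierFinset A k u) := by
      intro y hy
      rw [mem_sphere] at hy
      rw [Finset.mem_insert]
      exact h.mem_of_reach_boundary hgeo (show Reach A 0 v₁ v₁ from rfl) hul hy (by omega)
        (by omega)
    have hins := Finset.card_insert_le u (outlierFinset A k u)
    have hle := Finset.card_le_card hsub
    rw [card_sphere hreg hgeo (by omega)] at hle
    have hkl : k - l ≤ 2 := by
      by_contra! hlt
      have : 2 ^ 3 ≤ 2 ^ (k - l) := Nat.pow_le_pow_right (by omega) hlt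
      omega
    obtain rfl : l = k - 2 := by omega
    have hkl : k - (k - 2) = 2 := by omega
    rw [hkl] at hsub hle
    have heq := Finset.eq_of_subset_of_card_le hsub (by
      rw [card_sphere hreg hgeo (by omega)]
      omega)
    have hvu : Reach A 2 v₁ u := by
      rw [← mem_sphere, heq]
      exact Finset.mem_insert_self _ _
    have := h.lt_of_reach hgeo (by omega) hvu
    obtain rfl : k = 3 := by omega
    have hvout : v ∉ outlierFinset A 3 u := by
      intro hv
      have hvv : Reach A 2 v₁ v := by
        rw [← mem_sphere, heq]
        exact Finset.mem_insert_of_mem hv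
      have := hgeo.not_closed (hvv.cons h.adj_v₁) (by omega)
      omega
    obtain ⟨w, hw, hwv⟩ : Reach A 2 u₁ v := h.reach_v hgeo hvout
    replace hwv : Reach A 1 w v := hwv
    have hadj : A u₁ v₁ := reach_one.1 hul
    have hne : v₁ ≠ w := by
      rintro rfl
      have := hgeo.not_closed (hwv.cons h.adj_v₁) (by omega)
      omega
    obtain ⟨w', hw'⟩ := hreg.exists_other hadj
    obtain rfl : w = w' := ((hw' w).1 hw).resolve_left hne.symm
    have hwu : w ≠ u₂ := by
      rintro rfl
      have := hgeo.length_eq ((Reach.of_adj hw).cons h.adj_u₁) (.of_adj h.adj_u₂)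
        (by omega) (by omega)
      omega
    have h' : CommonOut A u₁ v w v₁ u₂ :=
      ⟨fun x => (hw' x).trans or_comm, fun x => (h.right x).trans or_comm, hwu, hne.symm,
        h.ne_right.symm⟩
    exact h'.not_reach_pred hreg hgeo hcard hk (hwv.trans (.of_adj h.adj_v₂))
  · exact mem_outlierFinset.1 ho m hm hm'

end CommonOut

/-- Fixed-pair setup, `k ≥ 3`: `v₁ ∈ O(u)` and `u₁ ∈ O(v)`. -/
theorem v1_outlier_and_u1_outlier {V : Type*} [Fintype V] (A : V → V → Prop) (k : ℕ)
    (u v u₁ u₂ v₁ : V)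
    (hirr : Irreflexive A) (hreg : IsDiregular A 2) (hgeo : IsKGeodetic A k)
    (hcard : Fintype.card V = moore 2 k + 3)
    (hu : Nout A u = {u₁, u₂}) (hv : Nout A v = {v₁, u₂}) (huv : u₁ ≠ v₁)
    (hk : 3 ≤ k) :
    v₁ ∈ Outliers A k u ∧ u₁ ∈ Outliers A k v := by
  have hne {a b c : V} (h : Nout A a = {b, c}) : b ≠ c := by
    rintro rfl
    have := (hreg a).1
    simp [h] at this
  have h : CommonOut A u v u₁ u₂ v₁ :=
    ⟨fun x => by simpa [Nout] using Set.ext_iff.1 hu x,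
      fun x => by simpa [Nout] using Set.ext_iff.1 hv x, huv, hne hu, hne hv⟩
  exact ⟨h.mem_outliers hreg hgeo hcard hk, h.symm.mem_outliers hreg hgeo hcard hk⟩
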